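/- Let 𝒫₁ and 𝒫₂ be finite posets, and let 𝒬 be a finite poset with the unique cover twin property and at least two elements. Then sat*(n, 𝒫₁*𝒬*𝒫₂) → ∞ as n → ∞; that is, for every constant B there exists n₀ such that sat*(n, 𝒫₁*𝒬*𝒫₂) > B for all n ≥ n₀. -/

import Mathlib

open Finset

/-- A family `F` of subsets of `[n]` (as subsets of `Fin n`) contains an induced copy of
the finite poset `P`: there is an injection `f : P → F` with `a ≤ b ↔ f a ⊆ f b`. -/
def ContainsCopy (P : Type) [PartialOrder P] {n : ℕ}
    (F : Set (Finset (Fin n))) : Prop :=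
  ∃ f : P → Finset (Fin n), Function.Injective f ∧ (∀ a, f a ∈ F) ∧
    ∀ a b : P, a ≤ b ↔ f a ⊆ f b

/-- `F` is `P`-saturated: it contains no induced copy of `P`, but adding any new set
creates one. -/
def IsSaturated (P : Type) [PartialOrder P] {n : ℕ}
    (F : Finset (Finset (Fin n))) : Prop :=
  ¬ ContainsCopy P (↑F : Set (Finset (Fin n))) ∧
    ∀ S : Finset (Fin n), S ∉ F →
      ContainsCopy P (insert S (↑F : Set (Finset (Fin n))))

/-- The induced saturation number `sat*(n, P)`. -/
noncomputable def satStar (n : ℕ) (P : Type) [PartialOrder P] : ℕ :=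
  sInf {m | ∃ F : Finset (Finset (Fin n)), IsSaturated P F ∧ F.card = m}

/-- The antichain poset `𝒜_k` with `k` elements. -/
def AC (k : ℕ) : Type := Fin k

instance (k : ℕ) : PartialOrder (AC k) where
  le a b := a = b
  le_refl _ := rfl
  le_trans _ _ _ h₁ h₂ := Eq.trans h₁ h₂
  le_antisymm _ _ h _ := h

instance (k : ℕ) : Fintype (AC k) := inferInstanceAs (Fintype (Fin k))

/-- A poset has the unique cover twin property (UCTP) if whenever `p₂` covers `p₁`, some
element is comparable with exactly one of `p₁`, `p₂`. -/
def UCTP (Q : Type) [PartialOrder Q] : Prop :=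
  ∀ p₁ p₂ : Q, p₁ ⋖ p₂ →
    ∃ p₃ : Q, Xor' (p₃ ≤ p₁ ∨ p₁ ≤ p₃) (p₃ ≤ p₂ ∨ p₂ ≤ p₃)

/-- `f` restricted to the elements satisfying `p` is an induced copy inside the family `F`. -/
def IsCopyOn {P α : Type*} [PartialOrder P] (F : Set (Finset α)) (p : P → Prop)
    (f : P → Finset α) : Prop :=
  (∀ a, p a → f a ∈ F) ∧ ∀ a b, p a → p b → (a ≤ b ↔ f a ⊆ f b)

/-- The part of the poset of nonpositive level has an induced copy in `F` inside `S`. -/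
def HasCopyBelow {P α : Type*} [PartialOrder P] (ℓ : P → ℤ) (F : Set (Finset α))
    (S : Finset α) : Prop :=
  ∃ f : P → Finset α, IsCopyOn F (fun a => ℓ a ≤ 0) f ∧ ∀ a, ℓ a ≤ 0 → f a ⊆ S

/-- The part of the poset of nonnegative level has an induced copy in `F` above `S`. -/
def HasCopyAbove {P α : Type*} [PartialOrder P] (ℓ : P → ℤ) (F : Set (Finset α))
    (S : Finset α) : Prop :=
  ∃ f : P → Finset α, IsCopyOn F (fun a => 0 ≤ ℓ a) f ∧ ∀ a, 0 ≤ ℓ a → S ⊆ f a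

section Copies

variable {P : Type} [PartialOrder P] {n : ℕ}

theorem IsCopyOn.containsCopy {F : Set (Finset (Fin n))} {f : P → Finset (Fin n)}
    (h : IsCopyOn F (fun _ => True) f) : ContainsCopy P F := by
  refine ⟨f, fun a b hab => ?_, fun a => h.1 a trivial, fun a b => h.2 a b trivial trivial⟩
  exact le_antisymm ((h.2 a b trivial trivial).2 hab.le) ((h.2 b a trivial trivial).2 hab.ge)

/-- A copy of a lower part and a copy of the complementary upper part, one inside the other,
form a copy of the whole poset. -/
theorem containsCopy_of_glue {F : Set (Finset (Fin n))} {p : P → Prop}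
    (hp : ∀ a b, p a → ¬ p b → a < b) {f g : P → Finset (Fin n)}
    (hf : IsCopyOn F p f) (hg : IsCopyOn F (fun a => ¬ p a) g)
    (hfg : ∀ a b, p a → ¬ p b → f a ⊂ g b) : ContainsCopy P F := by
  classical
  refine IsCopyOn.containsCopy (f := fun a => if p a then f a else g a) ⟨fun a _ => ?_, ?_⟩
  · by_cases ha : p a
    · simpa [ha] using hf.1 a ha
    · simpa [ha] using hg.1 a ha
  · intro a b _ _
    by_cases ha : p a <;> by_cases hb : p b <;> simp only [ha, hb, if_true, if_false]
    · exact hf.2 a b ha hb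
    · exact ⟨fun _ => (hfg a b ha hb).subset, fun _ => (hp a b ha hb).le⟩
    · exact ⟨fun h => absurd (hp b a hb ha) (not_lt_of_ge h),
        fun h => absurd h (hfg b a hb ha).not_subset⟩
    · exact hg.2 a b ha hb

variable {ℓ : P → ℤ} {F : Set (Finset (Fin n))} {φ : P → Finset (Fin n)}
  {S : Finset (Fin n)} {q : P}

theorem not_hasCopyBelow_of_lt (hℓ : ∀ a b, ℓ a < ℓ b → a < b) (hF : ¬ ContainsCopy P F)
    (hφF : ∀ a, 0 < ℓ a → φ a ∈ F) (hφ : ∀ a b, a ≤ b ↔ φ a ⊆ φ b)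
    (hS : ∀ a, 0 < ℓ a → S ⊂ φ a) : ¬ HasCopyBelow ℓ F S := by
  rintro ⟨f, hf, hfS⟩
  refine hF (containsCopy_of_glue (p := fun a => ℓ a ≤ 0) (g := φ)
    (fun a b ha hb => hℓ a b (by omega)) hf ⟨fun a ha => hφF a (by omega), fun a b _ _ => hφ a b⟩
    fun a b ha hb => lt_of_le_of_lt (hfS a ha) (hS b (by omega)))

theorem not_hasCopyAbove_of_lt (hℓ : ∀ a b, ℓ a < ℓ b → a < b) (hF : ¬ ContainsCopy P F)
    (hφF : ∀ a, ℓ a < 0 → φ a ∈ F) (hφ : ∀ a b, a ≤ b ↔ φ a ⊆ φ b)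
    (hS : ∀ a, ℓ a < 0 → φ a ⊂ S) : ¬ HasCopyAbove ℓ F S := by
  rintro ⟨f, hf, hfS⟩
  refine hF (containsCopy_of_glue (p := fun a => ℓ a < 0) (f := φ) (g := f)
    (fun a b ha hb => hℓ a b (by omega)) ⟨fun a ha => hφF a ha, fun a b _ _ => hφ a b⟩
    ⟨fun a ha => hf.1 a (by omega), fun a b ha hb => hf.2 a b (by omega) (by omega)⟩
    fun a b ha hb => lt_of_lt_of_le (hS a ha) (hfS b (by omega)))

/-- If adding `S` creates a copy, then `S` plays an element of level zero, unless a partial copy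
lies below or above `S`. -/
theorem exists_copy_through
    (hF : ¬ ContainsCopy P F) (hS : ContainsCopy P (insert S F))
    (hb : ¬ HasCopyBelow ℓ F S) (ha : ¬ HasCopyAbove ℓ F S) (hℓ : ∀ a b, ℓ a < ℓ b → a < b) :
    ∃ (φ : P → Finset (Fin n)) (q : P), (∀ a b, a ≤ b ↔ φ a ⊆ φ b) ∧ φ q = S ∧ ℓ q = 0 ∧
      ∀ a, a ≠ q → φ a ∈ F := by
  obtain ⟨φ, hinj, hmem, hφ⟩ := hS
  obtain ⟨q, hq⟩ : ∃ q, φ q = S := by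
    by_contra! h
    exact hF ⟨φ, hinj, fun a => (hmem a).resolve_left (h a), hφ⟩
  have hmem' : ∀ a, a ≠ q → φ a ∈ F := fun a haq =>
    (hmem a).resolve_left fun h => haq (hinj (h.trans hq.symm))
  refine ⟨φ, q, hφ, hq, ?_, hmem'⟩
  rcases lt_trichotomy (ℓ q) 0 with h | h | h
  · refine absurd ⟨φ, ⟨fun a h0 => hmem' a ?_, fun a b _ _ => hφ a b⟩, fun a h0 => ?_⟩ ha
    · rintro rfl; simp only at h0; omega
    · rw [← hq]; exact (hφ _ _).1 (hℓ _ _ (by omega)).le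
  · exact h
  · refine absurd ⟨φ, ⟨fun a h0 => hmem' a ?_, fun a b _ _ => hφ a b⟩, fun a h0 => ?_⟩ hb
    · rintro rfl; simp only at h0; omega
    · rw [← hq]; exact (hφ _ _).1 (hℓ _ _ (by omega)).le

theorem ssubset_of_lt_of_le_iff (hφ : ∀ a b, a ≤ b ↔ φ a ⊆ φ b) {a b : P} (h : a < b) :
    φ a ⊂ φ b :=
  ⟨(hφ a b).1 h.le, fun h' => not_le_of_gt h ((hφ b a).2 h')⟩

theorem not_hasCopyBelow_image (hℓ : ∀ a b, ℓ a < ℓ b → a < b) (hF : ¬ ContainsCopy P F)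
    (hφ : ∀ a b, a ≤ b ↔ φ a ⊆ φ b) (hq0 : ℓ q = 0)
    (hφF : ∀ a, a ≠ q → φ a ∈ F) {r : P} (hr : ℓ r = 0) : ¬ HasCopyBelow ℓ F (φ r) :=
  not_hasCopyBelow_of_lt hℓ hF (fun a h => hφF a (by rintro rfl; omega)) hφ
    fun a h => ssubset_of_lt_of_le_iff hφ (hℓ _ _ (by omega))

theorem not_hasCopyAbove_image (hℓ : ∀ a b, ℓ a < ℓ b → a < b) (hF : ¬ ContainsCopy P F)
    (hφ : ∀ a b, a ≤ b ↔ φ a ⊆ φ b) (hq0 : ℓ q = 0)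
    (hφF : ∀ a, a ≠ q → φ a ∈ F) {r : P} (hr : ℓ r = 0) : ¬ HasCopyAbove ℓ F (φ r) :=
  not_hasCopyAbove_of_lt hℓ hF (fun a h => hφF a (by rintro rfl; omega)) hφ
    fun a h => ssubset_of_lt_of_le_iff hφ (hℓ _ _ (by omega))

/-- If `A ∈ F` compares with the rest of a copy exactly as its element `φ q` does, then `A` is
itself part of the copy. -/
theorem mem_copy_of_same_comparabilities (hF : ¬ ContainsCopy P F)
    (hφ : ∀ a b, a ≤ b ↔ φ a ⊆ φ b) (hφF : ∀ a, a ≠ q → φ a ∈ F)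
    {A : Finset (Fin n)} (hA : A ∈ F)
    (hup : ∀ c, c ≠ q → φ c ≠ A → (A ⊆ φ c ↔ φ q ⊆ φ c))
    (hdown : ∀ c, c ≠ q → φ c ≠ A → (φ c ⊆ A ↔ φ c ⊆ φ q)) : ∃ a, a ≠ q ∧ φ a = A := by
  classical
  by_contra! h
  refine hF (IsCopyOn.containsCopy (f := Function.update φ q A) ⟨fun a _ => ?_, ?_⟩)
  · by_cases ha : a = q
    · simpa [ha] using hA
    · simpa [ha] using hφF a ha
  · intro a b _ _
    by_cases ha : a = q <;> by_cases hb : b = q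
    · simp [ha, hb]
    · subst ha; simp [hb, hup b hb (h b hb), hφ]
    · subst hb; simp [ha, hdown a ha (h a ha), hφ]
    · simp [ha, hb, hφ]

variable {i j : Fin n}

/-- If no set of a copy-free family separates `i` from `j`, some set separating them has no
partial copy below or above it. -/
theorem exists_separating_set (hℓ : ∀ a b, ℓ a < ℓ b → a < b)
    (hinc : ∃ a b, ℓ a = 0 ∧ ℓ b = 0 ∧ ¬ a ≤ b) (hF : ¬ ContainsCopy P F)
    (hij : i ≠ j) (htw : ∀ X ∈ F, i ∈ X ↔ j ∈ X) :
    ∃ S : Finset (Fin n), i ∈ S ∧ j ∉ S ∧ ¬ HasCopyBelow ℓ F S ∧ ¬ HasCopyAbove ℓ F S := by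
  classical
  by_contra! hall
  obtain ⟨a, b, ha, hb, hab⟩ := hinc
  have h0 : HasCopyAbove ℓ F ({i} : Finset (Fin n)) := by
    refine hall {i} (by simp) (by simpa using hij.symm) ?_
    rintro ⟨f, hf, hfS⟩
    refine hab ((hf.2 a b ha.le hb.le).2 ?_)
    have hai : i ∉ f a := fun h => hij.symm
      (by simpa using hfS a ha.le ((htw _ (hf.1 a ha.le)).1 h))
    intro x hx
    have := hfS a ha.le hx
    simp only [Finset.mem_singleton] at this
    exact absurd (this ▸ hx) hai
  obtain ⟨S, hSmax⟩ := Set.Finite.exists_maximal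
    (s := {S : Finset (Fin n) | i ∈ S ∧ j ∉ S ∧ HasCopyAbove ℓ F S}) (Set.toFinite _)
    ⟨{i}, by simp, by simpa using hij.symm, h0⟩
  obtain ⟨hiS, hjS, g, hg, hgS⟩ := hSmax.prop
  have key : ∀ c, ℓ c = 0 → g c = insert j S := by
    intro c hc
    refine subset_antisymm (fun x hx => ?_) ?_
    · by_contra hxn
      simp only [Finset.mem_insert, not_or] at hxn
      have hnab : ¬ HasCopyAbove ℓ F (insert x S) := fun h =>
        hxn.2 (hSmax.le_of_ge (y := insert x S) ⟨by simp [hiS], by simp [hjS, Ne.symm hxn.1], h⟩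
          (Finset.subset_insert _ _) (Finset.mem_insert_self _ _))
      have hbel : HasCopyBelow ℓ F (insert x S) := by
        by_contra h
        exact hnab (hall _ (by simp [hiS]) (by simp [hjS, Ne.symm hxn.1]) h)
      obtain ⟨f, hf, hfS⟩ := hbel
      refine hF (containsCopy_of_glue (p := fun a => ℓ a ≤ 0) (f := f) (g := g)
        (fun a b ha hb => hℓ a b (by omega)) hf
        ⟨fun a ha => hg.1 a (by omega), fun a b ha hb => hg.2 a b (by omega) (by omega)⟩ ?_)
      intro a b ha hb
      have hb0 : 0 ≤ ℓ b := by omega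
      have hxb : x ∈ g b := (hg.2 c b hc.ge hb0).1 (hℓ _ _ (by omega)).le hx
      have hia : i ∉ f a := fun h => by
        have := hfS a ha ((htw _ (hf.1 a ha)).1 h)
        simp [hjS, Ne.symm hxn.1] at this
      refine (Finset.ssubset_iff_of_subset ?_).2 ⟨i, hgS b hb0 hiS, hia⟩
      exact (hfS a ha).trans (Finset.insert_subset hxb (hgS b hb0))
    · exact Finset.insert_subset ((htw _ (hg.1 c hc.ge)).1 (hgS c hc.ge hiS)) (hgS c hc.ge)
  exact hab ((hg.2 a b ha.ge hb.ge).2 (by rw [key a ha, key b hb]))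

end Copies

section Saturated

variable {P : Type} [PartialOrder P] {n : ℕ} {ℓ : P → ℤ} {F : Set (Finset (Fin n))}
  {i j : Fin n}

/-- If no member of a saturated family separates `i` from `j`, then among the members with no
partial copy below or above them, none is maximal with the property of avoiding `i`: the set
`insert i A` would be a twin of `A`. -/
theorem false_of_maximal_avoiding (hℓ : ∀ a b, ℓ a < ℓ b → a < b)
    (huc : ∀ a b, ℓ a = 0 → ℓ b = 0 → a ⋖ b → ∃ c, ¬ (c ≤ a ∨ a ≤ c ↔ c ≤ b ∨ b ≤ c))
    (hmin : ∀ m, ℓ m = 0 → ∃ r, ℓ r = 0 ∧ ¬ m ≤ r)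
    (hF : ¬ ContainsCopy P F) (hsat : ∀ S, S ∉ F → ContainsCopy P (insert S F))
    (hij : i ≠ j) (htw : ∀ X ∈ F, i ∈ X ↔ j ∈ X) {A : Finset (Fin n)}
    (hA : Maximal (fun X => X ∈ F ∧ ¬ HasCopyBelow ℓ F X ∧ ¬ HasCopyAbove ℓ F X ∧ i ∉ X) A) :
    False := by
  classical
  obtain ⟨hAF, hAb, hAa, hiA⟩ := hA.prop
  have hjS : j ∉ insert i A := by simp [hij.symm, ← htw A hAF, hiA]
  have hsub : ∀ X ∈ F, X ⊆ insert i A → X ⊆ A := fun X hX h =>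
    (Finset.subset_insert_iff_of_notMem fun hi => hjS (h ((htw X hX).1 hi))).1 h
  obtain ⟨φ, q, hφ, hqS, hq0, hφF⟩ := exists_copy_through (ℓ := ℓ) (S := insert i A) hF
    (hsat _ fun h => hjS ((htw _ h).1 (Finset.mem_insert_self _ _)))
    (fun ⟨f, hf, hfS⟩ => hAb ⟨f, hf, fun a ha => hsub _ (hf.1 a ha) (hfS a ha)⟩)
    (fun ⟨f, hf, hfS⟩ => hAa ⟨f, hf, fun a ha => (Finset.subset_insert _ _).trans (hfS a ha)⟩) hℓ
  have hdown : ∀ c, c ≠ q → φ c ≠ A → (φ c ⊆ A ↔ φ c ⊆ φ q) := fun c hc _ =>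
    ⟨fun h => hqS ▸ h.trans (Finset.subset_insert _ _), fun h => hsub _ (hφF c hc) (hqS ▸ h)⟩
  have hup : ∀ c, c ≠ q → φ c ≠ A → (A ⊆ φ c ↔ φ q ⊆ φ c) := by
    intro c hc hcA
    refine ⟨fun h => ?_, fun h => (Finset.subset_insert i A).trans (hqS ▸ h)⟩
    by_cases hi : i ∈ φ c
    · exact hqS ▸ Finset.insert_subset hi h
    by_contra hn
    have h1 : ¬ q < c := fun hlt => hn ((hφ _ _).1 hlt.le)
    have h2 : ¬ c < q := fun hlt =>
      hcA (subset_antisymm ((hdown c hc hcA).2 ((hφ _ _).1 hlt.le)) h)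
    have hc0 : ℓ c = 0 := by
      have := mt (hℓ q c) h1
      have := mt (hℓ c q) h2
      omega
    exact hcA (subset_antisymm (hA.le_of_ge ⟨hφF c hc,
      not_hasCopyBelow_image hℓ hF hφ hq0 hφF hc0,
      not_hasCopyAbove_image hℓ hF hφ hq0 hφF hc0, hi⟩ h) h)
  obtain ⟨a, haq, haA⟩ := mem_copy_of_same_comparabilities hF hφ hφF hAF hup hdown
  have hne : ∀ c, c ≠ a → φ c ≠ A := fun c hca h =>
    hca (le_antisymm ((hφ _ _).2 (h.trans haA.symm).le) ((hφ _ _).2 (haA.trans h.symm).le))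
  have hlt : a < q := lt_of_le_of_ne
    ((hφ _ _).2 (haA ▸ hqS ▸ Finset.subset_insert _ _)) haq
  have hcu : ∀ c, c ≠ q → c ≠ a → (a ≤ c ↔ q ≤ c) := fun c hc hca => by
    rw [hφ, hφ, haA]; exact hup c hc (hne c hca)
  have hcd : ∀ c, c ≠ q → c ≠ a → (c ≤ a ↔ c ≤ q) := fun c hc hca => by
    rw [hφ, hφ, haA]; exact hdown c hc (hne c hca)
  rcases lt_trichotomy (ℓ a) 0 with h | h | h
  · obtain ⟨r, hr0, hr⟩ := hmin q hq0
    refine hr ((hcu r ?_ ?_).1 (hℓ _ _ (by omega)).le)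
    · rintro rfl; exact hr le_rfl
    · rintro rfl; omega
  · obtain ⟨c, hc⟩ := huc a q h hq0 ⟨hlt, fun c hac hcq =>
      (not_le_of_gt hcq) ((hcu c hcq.ne hac.ne').1 hac.le)⟩
    by_cases hca : c = a
    · subst hca; simp [hlt.le] at hc
    by_cases hcq : c = q
    · subst hcq; simp [hlt.le] at hc
    exact hc (by rw [hcu c hcq hca, hcd c hcq hca])
  · exact lt_asymm hlt (hℓ _ _ (by omega))

/-- The dual of `false_of_maximal_avoiding`, for a minimal member containing `i`. -/
theorem false_of_minimal_containing (hℓ : ∀ a b, ℓ a < ℓ b → a < b)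
    (huc : ∀ a b, ℓ a = 0 → ℓ b = 0 → a ⋖ b → ∃ c, ¬ (c ≤ a ∨ a ≤ c ↔ c ≤ b ∨ b ≤ c))
    (hmax : ∀ m, ℓ m = 0 → ∃ r, ℓ r = 0 ∧ ¬ r ≤ m)
    (hF : ¬ ContainsCopy P F) (hsat : ∀ S, S ∉ F → ContainsCopy P (insert S F))
    (hij : i ≠ j) (htw : ∀ X ∈ F, i ∈ X ↔ j ∈ X) {A : Finset (Fin n)}
    (hA : Minimal (fun X => X ∈ F ∧ ¬ HasCopyBelow ℓ F X ∧ ¬ HasCopyAbove ℓ F X ∧ i ∈ X) A) :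
    False := by
  classical
  obtain ⟨hAF, hAb, hAa, hiA⟩ := hA.prop
  have hjS : j ∈ A.erase i := by simp [hij.symm, ← htw A hAF, hiA]
  have hsub : ∀ X ∈ F, A.erase i ⊆ X → A ⊆ X := fun X hX h x hx => by
    by_cases hxi : x = i
    · exact hxi ▸ (htw X hX).2 (h hjS)
    · exact h (Finset.mem_erase.2 ⟨hxi, hx⟩)
  obtain ⟨φ, q, hφ, hqS, hq0, hφF⟩ := exists_copy_through (ℓ := ℓ) (S := A.erase i) hF
    (hsat _ fun h => Finset.notMem_erase i A ((htw _ h).2 hjS))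
    (fun ⟨f, hf, hfS⟩ => hAb ⟨f, hf, fun a ha => (hfS a ha).trans (Finset.erase_subset _ _)⟩)
    (fun ⟨f, hf, hfS⟩ => hAa ⟨f, hf, fun a ha => hsub _ (hf.1 a ha) (hfS a ha)⟩) hℓ
  have hup : ∀ c, c ≠ q → φ c ≠ A → (A ⊆ φ c ↔ φ q ⊆ φ c) := fun c hc _ =>
    ⟨fun h => hqS ▸ (Finset.erase_subset _ _).trans h, fun h => hsub _ (hφF c hc) (hqS ▸ h)⟩
  have hdown : ∀ c, c ≠ q → φ c ≠ A → (φ c ⊆ A ↔ φ c ⊆ φ q) := by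
    intro c hc hcA
    refine ⟨fun h => ?_, fun h => (hqS ▸ h : φ c ⊆ A.erase i).trans (Finset.erase_subset i A)⟩
    by_cases hi : i ∈ φ c
    swap
    · exact hqS ▸ Finset.subset_erase.2 ⟨h, hi⟩
    by_contra hn
    have h1 : ¬ c < q := fun hlt => hn ((hφ _ _).1 hlt.le)
    have h2 : ¬ q < c := fun hlt =>
      hcA (subset_antisymm h ((hup c hc hcA).2 ((hφ _ _).1 hlt.le)))
    have hc0 : ℓ c = 0 := by
      have := mt (hℓ c q) h1
      have := mt (hℓ q c) h2
      omega
    exact hcA (subset_antisymm h (hA.le_of_le ⟨hφF c hc,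
      not_hasCopyBelow_image hℓ hF hφ hq0 hφF hc0,
      not_hasCopyAbove_image hℓ hF hφ hq0 hφF hc0, hi⟩ h))
  obtain ⟨a, haq, haA⟩ := mem_copy_of_same_comparabilities hF hφ hφF hAF hup hdown
  have hne : ∀ c, c ≠ a → φ c ≠ A := fun c hca h =>
    hca (le_antisymm ((hφ _ _).2 (h.trans haA.symm).le) ((hφ _ _).2 (haA.trans h.symm).le))
  have hlt : q < a := lt_of_le_of_ne
    ((hφ _ _).2 (haA ▸ hqS ▸ Finset.erase_subset _ _)) haq.symm
  have hcu : ∀ c, c ≠ q → c ≠ a → (a ≤ c ↔ q ≤ c) := fun c hc hca => by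
    rw [hφ, hφ, haA]; exact hup c hc (hne c hca)
  have hcd : ∀ c, c ≠ q → c ≠ a → (c ≤ a ↔ c ≤ q) := fun c hc hca => by
    rw [hφ, hφ, haA]; exact hdown c hc (hne c hca)
  rcases lt_trichotomy (ℓ a) 0 with h | h | h
  · exact lt_asymm hlt (hℓ _ _ (by omega))
  · obtain ⟨c, hc⟩ := huc q a hq0 h ⟨hlt, fun c hqc hca =>
      (not_le_of_gt hqc) ((hcd c hqc.ne' hca.ne).1 hca.le)⟩
    by_cases hca : c = a
    · subst hca; simp [hlt.le] at hc
    by_cases hcq : c = q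
    · subst hcq; simp [hlt.le] at hc
    exact hc (by rw [hcu c hcq hca, hcd c hcq hca])
  · obtain ⟨r, hr0, hr⟩ := hmax q hq0
    refine hr ((hcd r ?_ ?_).1 (hℓ _ _ (by omega)).le)
    · rintro rfl; exact hr le_rfl
    · rintro rfl; omega

theorem exists_separating_of_no_extrema (hℓ : ∀ a b, ℓ a < ℓ b → a < b)
    (huc : ∀ a b, ℓ a = 0 → ℓ b = 0 → a ⋖ b → ∃ c, ¬ (c ≤ a ∨ a ≤ c ↔ c ≤ b ∨ b ≤ c))
    (hinc : ∃ a b, ℓ a = 0 ∧ ℓ b = 0 ∧ ¬ a ≤ b)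
    (hmin : ∀ m, ℓ m = 0 → ∃ r, ℓ r = 0 ∧ ¬ m ≤ r)
    (hmax : ∀ m, ℓ m = 0 → ∃ r, ℓ r = 0 ∧ ¬ r ≤ m)
    (hF : ¬ ContainsCopy P F) (hsat : ∀ S, S ∉ F → ContainsCopy P (insert S F))
    (hij : i ≠ j) : ∃ X ∈ F, ¬ (i ∈ X ↔ j ∈ X) := by
  by_contra! htw
  obtain ⟨S, hiS, hjS, hSb, hSa⟩ := exists_separating_set hℓ hinc hF hij htw
  obtain ⟨φ, q, hφ, hqS, hq0, hφF⟩ := exists_copy_through hF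
    (hsat S fun h => hjS ((htw S h).1 hiS)) hSb hSa hℓ
  obtain ⟨r, hr0, hr⟩ := hmin q hq0
  have hrq : r ≠ q := by rintro rfl; exact hr le_rfl
  have hrb := not_hasCopyBelow_image hℓ hF hφ hq0 hφF hr0
  have hra := not_hasCopyAbove_image hℓ hF hφ hq0 hφF hr0
  by_cases hi : i ∈ φ r
  · obtain ⟨A, hA⟩ := Set.Finite.exists_minimal
      (s := {X | X ∈ F ∧ ¬ HasCopyBelow ℓ F X ∧ ¬ HasCopyAbove ℓ F X ∧ i ∈ X})
      (Set.toFinite _) ⟨φ r, hφF r hrq, hrb, hra, hi⟩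
    exact false_of_minimal_containing hℓ huc hmax hF hsat hij htw hA
  · obtain ⟨A, hA⟩ := Set.Finite.exists_maximal
      (s := {X | X ∈ F ∧ ¬ HasCopyBelow ℓ F X ∧ ¬ HasCopyAbove ℓ F X ∧ i ∉ X})
      (Set.toFinite _) ⟨φ r, hφF r hrq, hrb, hra, hi⟩
    exact false_of_maximal_avoiding hℓ huc hmin hF hsat hij htw hA

/-- A saturated family separates all pairs of points. The elements of level zero are reduced to
a set without least or greatest element by moving such elements to another level. -/
theorem exists_separating [Fintype P] (hℓ : ∀ a b, ℓ a < ℓ b → a < b)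
    (huc : ∀ a b, ℓ a = 0 → ℓ b = 0 → a ⋖ b → ∃ c, ¬ (c ≤ a ∨ a ≤ c ↔ c ≤ b ∨ b ≤ c))
    (hinc : ∃ a b, ℓ a = 0 ∧ ℓ b = 0 ∧ ¬ a ≤ b ∧ ¬ b ≤ a)
    (hF : ¬ ContainsCopy P F) (hsat : ∀ S, S ∉ F → ContainsCopy P (insert S F))
    (hij : i ≠ j) : ∃ X ∈ F, ¬ (i ∈ X ↔ j ∈ X) := by
  classical
  induction hk : (Finset.univ.filter fun a => ℓ a = 0).card using Nat.strong_induction_on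
    generalizing ℓ with
  | _ k ih =>
  have hmove : ∀ (m : P) (t : ℤ), ℓ m = 0 → t ≠ 0 →
      (∀ a b, Function.update ℓ m t a < Function.update ℓ m t b → a < b) →
      ((∀ r, ℓ r = 0 → m ≤ r) ∨ ∀ r, ℓ r = 0 → r ≤ m) → ∃ X ∈ F, ¬ (i ∈ X ↔ j ∈ X) := by
    intro m t hm ht hord hext
    have hz : ∀ a, Function.update ℓ m t a = 0 ↔ ℓ a = 0 ∧ a ≠ m := fun a => by
      by_cases h : a = m <;> simp [h, ht]
    refine ih _ ?_ hord (fun a b ha hb => huc a b ((hz a).1 ha).1 ((hz b).1 hb).1) ?_ rfl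
    · rw [← hk]
      refine Finset.card_lt_card ((Finset.ssubset_iff_of_subset fun a ha => ?_).2 ⟨m, ?_, ?_⟩)
      · simpa using ((hz a).1 (by simpa using ha)).1
      · simpa using hm
      · simpa using ht
    · obtain ⟨a, b, ha, hb, hab, hba⟩ := hinc
      refine ⟨a, b, (hz a).2 ⟨ha, ?_⟩, (hz b).2 ⟨hb, ?_⟩, hab, hba⟩
      · rintro rfl
        exact hext.elim (fun h => hab (h b hb)) fun h => hba (h b hb)
      · rintro rfl
        exact hext.elim (fun h => hba (h a ha)) fun h => hab (h a ha)
  by_cases hmin : ∃ m, ℓ m = 0 ∧ ∀ r, ℓ r = 0 → m ≤ r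
  · obtain ⟨m, hm, hmr⟩ := hmin
    refine hmove m (-1) hm (by norm_num) (fun a b hab => ?_) (Or.inl hmr)
    by_cases ha : a = m <;> by_cases hb : b = m
    · simp [ha, hb] at hab
    · subst ha
      simp only [Function.update_self, Function.update_of_ne hb] at hab
      rcases (show ℓ b = 0 ∨ 0 < ℓ b by omega) with h | h
      · exact lt_of_le_of_ne (hmr b h) (Ne.symm hb)
      · exact hℓ _ _ (by omega)
    · subst hb
      simp only [Function.update_self, Function.update_of_ne ha] at hab
      exact hℓ _ _ (by omega)
    · simp only [Function.update_of_ne ha, Function.update_of_ne hb] at hab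
      exact hℓ _ _ hab
  by_cases hmax : ∃ m, ℓ m = 0 ∧ ∀ r, ℓ r = 0 → r ≤ m
  · obtain ⟨m, hm, hmr⟩ := hmax
    refine hmove m 1 hm (by norm_num) (fun a b hab => ?_) (Or.inr hmr)
    by_cases ha : a = m <;> by_cases hb : b = m
    · simp [ha, hb] at hab
    · subst ha
      simp only [Function.update_self, Function.update_of_ne hb] at hab
      exact hℓ _ _ (by omega)
    · subst hb
      simp only [Function.update_self, Function.update_of_ne ha] at hab
      rcases (show ℓ a = 0 ∨ ℓ a < 0 by omega) with h | h
      · exact lt_of_le_of_ne (hmr a h) ha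
      · exact hℓ _ _ (by omega)
    · simp only [Function.update_of_ne ha, Function.update_of_ne hb] at hab
      exact hℓ _ _ hab
  push Not at hmin hmax
  obtain ⟨a, b, ha, hb, hab, -⟩ := hinc
  exact exists_separating_of_no_extrema hℓ huc ⟨a, b, ha, hb, hab⟩ hmin hmax hF hsat hij

end Saturated

theorem exists_isSaturated (P : Type) [PartialOrder P] [Nonempty P] (n : ℕ) :
    ∃ F : Finset (Finset (Fin n)), IsSaturated P F := by
  obtain ⟨F, hF⟩ := Set.Finite.exists_maximal
    (s := {F : Finset (Finset (Fin n)) | ¬ ContainsCopy P (↑F : Set (Finset (Fin n)))})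
    (Set.toFinite _) ⟨∅, fun ⟨f, _, h, _⟩ => by simpa using h (Classical.arbitrary P)⟩
  refine ⟨F, hF.prop, fun S hS => ?_⟩
  by_contra h
  refine hS (hF.le_of_ge (y := insert S F) ?_ (Finset.subset_insert _ _)
    (Finset.mem_insert_self _ _))
  simpa using h

/-- A family separating all pairs of points has at least logarithmic size. -/
theorem le_two_pow_card_of_separating {n : ℕ} {F : Finset (Finset (Fin n))}
    (h : ∀ i j : Fin n, i ≠ j → ∃ X ∈ F, ¬ (i ∈ X ↔ j ∈ X)) : n ≤ 2 ^ F.card := by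
  classical
  rw [← Finset.card_powerset]
  conv_lhs => rw [← Finset.card_fin n]
  refine Finset.card_le_card_of_injOn (fun i => F.filter fun X => i ∈ X)
    (fun i _ => Finset.mem_powerset.2 (Finset.filter_subset _ _)) fun i _ j _ hij => ?_
  by_contra hne
  obtain ⟨X, hX, hXij⟩ := h i j hne
  have := Finset.ext_iff.1 hij X
  simp only [Finset.mem_filter, hX, true_and] at this
  exact hXij this

theorem UCTP.exists_incomparable {Q : Type} [PartialOrder Q] [Fintype Q] (hQ : UCTP Q)
    (hQcard : 2 ≤ Fintype.card Q) : ∃ a b : Q, ¬ a ≤ b ∧ ¬ b ≤ a := by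
  by_contra! h
  obtain ⟨a, b, hab⟩ := Fintype.one_lt_card_iff.1 hQcard
  have htot : ∀ x y : Q, x ≤ y ∨ y ≤ x := fun x y => or_iff_not_imp_left.2 (h x y)
  have key : ∀ x y : Q, ¬ x < y := fun x y hxy => by
    obtain ⟨z, hz, -⟩ := exists_covBy_le_of_lt hxy
    obtain ⟨c, hc⟩ := hQ x z hz
    exact xor_iff_not_iff _ _ |>.1 hc (by simp [htot])
  rcases htot a b with h | h
  · exact key _ _ (lt_of_le_of_ne h hab)
  · exact key _ _ (lt_of_le_of_ne h hab.symm)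

/-- The level of an element of a threefold linear sum; the middle summand has level zero. -/
def sumLevel (P₁ P₂ Q : Type) (x : P₂ ⊕ₗ (Q ⊕ₗ P₁)) : ℤ :=
  Sum.elim (fun _ => -1) (fun y => Sum.elim (fun _ => 0) (fun _ => 1) (ofLex y)) (ofLex x)

/-- if `Q` has the UCTP and at least two elements, then
`sat*(n, P₁*Q*P₂) → ∞`. -/
theorem statement19 (P₁ P₂ Q : Type) [PartialOrder P₁] [PartialOrder P₂] [PartialOrder Q]
    [Fintype P₁] [Fintype P₂] [Fintype Q]
    (hQcard : 2 ≤ Fintype.card Q) (hQ : UCTP Q) :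
    ∀ B : ℕ, ∃ n₀ : ℕ, ∀ n : ℕ, n₀ ≤ n → B < satStar n (P₂ ⊕ₗ (Q ⊕ₗ P₁)) := by
  intro B
  refine ⟨2 ^ B + 1, fun n hn => ?_⟩
  obtain ⟨a, b, hab, hba⟩ := hQ.exists_incomparable hQcard
  let ι : Q → P₂ ⊕ₗ (Q ⊕ₗ P₁) := fun q => toLex (Sum.inr (toLex (Sum.inl q)))
  have hι : ∀ x y : Q, ι x ≤ ι y ↔ x ≤ y := fun x y => by
    simp [ι]
  have hιlt : ∀ x y : Q, ι x < ι y ↔ x < y := fun x y => by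
    rw [lt_iff_le_not_ge, lt_iff_le_not_ge, hι, hι]
  have hlevel : ∀ x, sumLevel P₁ P₂ Q x = 0 → ∃ q, ι q = x := by
    rintro (x | x | x) hx
    · exact absurd hx (show (-1 : ℤ) ≠ 0 by norm_num)
    · exact ⟨x, rfl⟩
    · exact absurd hx (show (1 : ℤ) ≠ 0 by norm_num)
  have hne : Nonempty (P₂ ⊕ₗ (Q ⊕ₗ P₁)) := ⟨ι a⟩
  have : Fintype (P₂ ⊕ₗ (Q ⊕ₗ P₁)) := inferInstanceAs (Fintype (P₂ ⊕ (Q ⊕ P₁)))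
  obtain ⟨F₀, hF₀⟩ := exists_isSaturated (P₂ ⊕ₗ (Q ⊕ₗ P₁)) n
  obtain ⟨F, hF, hcard⟩ : satStar n (P₂ ⊕ₗ (Q ⊕ₗ P₁)) ∈ {m | ∃ F : Finset (Finset (Fin n)),
      IsSaturated (P₂ ⊕ₗ (Q ⊕ₗ P₁)) F ∧ F.card = m} := Nat.sInf_mem ⟨_, F₀, hF₀, rfl⟩
  rw [← hcard]
  refine (Nat.pow_lt_pow_iff_right (a := 2) (by norm_num)).1 (lt_of_lt_of_le hn ?_)
  refine le_two_pow_card_of_separating fun i j hij => ?_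
  refine exists_separating (ℓ := sumLevel P₁ P₂ Q) (F := (↑F : Set (Finset (Fin n))))
    ?_ ?_ ⟨ι a, ι b, rfl, rfl, mt (hι a b).1 hab, mt (hι b a).1 hba⟩ hF.1
    (fun S hS => hF.2 S hS) hij
  · rintro (x | x | x) (y | y | y) hxy
    · exact absurd hxy (show ¬ (-1 : ℤ) < -1 by norm_num)
    · exact Sum.Lex.inl_lt_inr _ _
    · exact Sum.Lex.inl_lt_inr _ _
    · exact absurd hxy (show ¬ (0 : ℤ) < -1 by norm_num)
    · exact absurd hxy (show ¬ (0 : ℤ) < 0 by norm_num)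
    · exact Sum.Lex.inr_lt_inr_iff.2 (Sum.Lex.inl_lt_inr _ _)
    · exact absurd hxy (show ¬ (1 : ℤ) < -1 by norm_num)
    · exact absurd hxy (show ¬ (1 : ℤ) < 0 by norm_num)
    · exact absurd hxy (show ¬ (1 : ℤ) < 1 by norm_num)
  · intro x y hx hy hxy
    obtain ⟨x, rfl⟩ := hlevel x hx
    obtain ⟨y, rfl⟩ := hlevel y hy
    obtain ⟨c, hc⟩ := hQ x y ⟨(hιlt x y).1 hxy.1, fun z h1 h2 =>
      hxy.2 ((hιlt _ _).2 h1) ((hιlt _ _).2 h2)⟩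
    exact ⟨ι c, by simpa only [hι] using xor_iff_not_iff _ _ |>.1 hc⟩
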